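/- In the Δ-fair multiple-flow Reno model with w_i ≥ 2 and at most n/w* + s halving flows (w* = Δ⁺·BDP/n), if we want guaranteed utilization at least γ ∈ (0,1] with zero buffer (B = 0), it suffices that s ≤ (1−γ)·n/Δ⁺. -/

import Mathlib

/-- Halving the flows of `D` and incrementing the others costs at most `c` per halving flow,
against a gain of one per flow, when all windows lie in `[2, c]`. -/
theorem sum_halve_or_succ_ge {ι : Type*} [Fintype ι] [DecidableEq ι] (w : ι → ℝ) (D : Finset ι)
    (c : ℝ) (hlow : ∀ i, 2 ≤ w i) (hc : ∀ i, w i ≤ c) :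
    ∑ i, w i + Fintype.card ι - D.card * c ≤ ∑ i, (if i ∈ D then w i / 2 else w i + 1) := by
  have h : ∑ i, (w i + 1 - if i ∈ D then c else 0) ≤
      ∑ i, (if i ∈ D then w i / 2 else w i + 1) := by
    refine Finset.sum_le_sum fun i _ => ?_
    split_ifs <;> linarith [hlow i, hc i]
  simpa [Finset.sum_sub_distrib, Finset.sum_add_distrib, Finset.sum_ite_mem] using h

/-- in the Δ-fair multiple-flow Reno model with zero buffer, if
at most `n/w* + s` flows halve (with `w* = Δ⁺ BDP/n`) and
`s ≤ (1-γ) n / Δ⁺`, then utilization is at least `γ`. -/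
theorem zero_buffer_target_utilization
    (n : ℕ) (hn : 1 ≤ n) (BDP Δp s γ : ℝ) (hBDP : 0 < BDP) (hΔp : 1 ≤ Δp)
    (hs : 0 ≤ s) (hγ0 : 0 < γ) (hγ1 : γ ≤ 1)
    (hsle : s ≤ (1 - γ) * n / Δp)
    (w : Fin n → ℝ) (D : Finset (Fin n))
    (hfair : ∀ i, w i ≤ Δp * BDP / n)
    (hlow : ∀ i, 2 ≤ w i)
    (hagg : ∑ i, w i ≥ BDP + 0)
    (hD : (D.card : ℝ) ≤ (n : ℝ) / (Δp * BDP / n) + s) :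
    min ((∑ i, (if i ∈ D then w i / 2 else w i + 1)) / BDP) 1 ≥ γ := by
  have hn' : (0 : ℝ) < n := by exact_mod_cast hn
  have hΔ : 0 < Δp := by linarith
  have hw : 0 < Δp * BDP / n := by positivity
  have hsum := sum_halve_or_succ_ge w D _ hlow hfair
  rw [Fintype.card_fin] at hsum
  have hcard := mul_le_mul_of_nonneg_right hD hw.le
  rw [add_mul, div_mul_cancel₀ _ hw.ne'] at hcard
  have hslack : s * (Δp * BDP / n) ≤ (1 - γ) * BDP :=
    (mul_le_mul_of_nonneg_right hsle hw.le).trans_eq (by field_simp)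
  refine le_min ?_ hγ1
  rw [le_div_iff₀ hBDP]
  linarith
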